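/- Let X and X_n (n ∈ ℕ) be mm-spaces. Suppose that for each n ∈ ℕ there exist a Borel measurable map p_n : X_n → X, a Borel subset X̃_n ⊆ X_n, and ε_n > 0 such that (1) ε_n → 0 as n → ∞; (2) μ_{X_n}(X_n \ X̃_n) ≤ ε_n for all n; (3) |d_{X_n}(x,y) − d_X(p_n(x), p_n(y))| ≤ ε_n for all x, y ∈ X̃_n; and (4) the sequence {(p_n)_*(μ_{X_n})} converges weakly to μ_X. Then □̲_1(X_n, X) → 0 as n → ∞. -/

import Mathlib

open MeasureTheory Set Filter Topology

noncomputable section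

/-- Lebesgue measure restricted to the interval `[0, m]`. -/
def lebIcc (m : ℝ) : Measure ℝ := volume.restrict (Icc 0 m)

/-- `φ : [0,m] → X` is a parameter of the mm-space `(X, d_X, μX)`:
a Borel measurable map pushing Lebesgue measure on `[0,m]` forward to `μX`. -/
def IsParameter {X : Type*} [MeasurableSpace X] (μX : Measure X) (m : ℝ) (φ : ℝ → X) : Prop :=
  Measurable φ ∧ Measure.map φ (lebIcc m) = μX

/-- The pullback `φ*d_X` of the distance of `X` under `φ`. -/
def pb {X : Type*} [PseudoMetricSpace X] (φ : ℝ → X) : ℝ → ℝ → ℝ :=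
  fun s t => dist (φ s) (φ t)

/-- The distance `□_λ(d₁, d₂)` between two maps `d₁ d₂ : α × α → ℝ` over a finite
measure space `(α, μ)`. -/
def boxDist {α : Type*} [MeasurableSpace α] (μ : Measure α) (lam : ℝ)
    (d₁ d₂ : α → α → ℝ) : ℝ :=
  sInf {ε : ℝ | 0 < ε ∧ ∃ T : Set α, MeasurableSet T ∧
    (μ univ).toReal - lam * ε ≤ (μ T).toReal ∧
    ∀ x ∈ T, ∀ y ∈ T, |d₁ x y - d₂ x y| ≤ ε}

/-- `inf □_λ(φX*d_X, φY*d_Y)` over all parameters, for mm-spaces of equal total mass `m`. -/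
def boxInf {X Y : Type*} [PseudoMetricSpace X] [MeasurableSpace X]
    [PseudoMetricSpace Y] [MeasurableSpace Y] (lam m : ℝ)
    (μX : Measure X) (μY : Measure Y) : ℝ :=
  sInf {r : ℝ | ∃ (φX : ℝ → X) (φY : ℝ → Y), IsParameter μX m φX ∧ IsParameter μY m φY ∧
    r = boxDist (lebIcc m) lam (pb φX) (pb φY)}

open Classical in
/-- Gromov's box distance `□̲_λ(X, Y)` between mm-spaces. -/
def mmBox {X Y : Type*} [PseudoMetricSpace X] [MeasurableSpace X]
    [PseudoMetricSpace Y] [MeasurableSpace Y] (lam : ℝ)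
    (μX : Measure X) (μY : Measure Y) : ℝ :=
  if (μX univ).toReal = (μY univ).toReal then
    boxInf lam (μX univ).toReal μX μY
  else if (μX univ).toReal < (μY univ).toReal then
    boxInf lam (μX univ).toReal μX
      ((ENNReal.ofReal ((μX univ).toReal / (μY univ).toReal)) • μY)
      + ((μY univ).toReal - (μX univ).toReal)
  else
    boxInf lam (μY univ).toReal
      ((ENNReal.ofReal ((μY univ).toReal / (μX univ).toReal)) • μX) μY
      + ((μX univ).toReal - (μY univ).toReal)

/-- The measure `μ̲_r` on `r × r` real matrices: the pushforward of `μ^r` under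
`(x₁, …, x_r) ↦ (d(x_i, x_j))_{i,j}`, for a (pseudo)distance `d`. -/
def matMeasure {α : Type*} [MeasurableSpace α] (μ : Measure α) (d : α → α → ℝ) (r : ℕ) :
    Measure (Fin r → Fin r → ℝ) :=
  Measure.map (fun x : Fin r → α => fun i j => d (x i) (x j)) (Measure.pi fun _ : Fin r => μ)

/-- The support of a Borel measure. -/
def msupport {X : Type*} [TopologicalSpace X] [MeasurableSpace X] (μ : Measure X) : Set X :=
  {x | ∀ U : Set X, IsOpen U → x ∈ U → 0 < μ U}

/-- Two mm-spaces are isomorphic: there is a measure preserving isometry (bijective)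
between the supports of their measures. -/
def MMIsom {X Y : Type*} [MetricSpace X] [MeasurableSpace X] [MetricSpace Y] [MeasurableSpace Y]
    (μX : Measure X) (μY : Measure Y) : Prop :=
  ∃ f : msupport μX → msupport μY, Function.Bijective f ∧ Isometry f ∧
    Measure.map f (Measure.comap Subtype.val μX) = Measure.comap Subtype.val μY

/-- The distance `me_λ` on the space of all real valued functions on `(α, μ)`. -/
def meDist {α : Type*} [MeasurableSpace α] (μ : Measure α) (lam : ℝ) (f g : α → ℝ) : ℝ :=
  sInf {ε : ℝ | 0 < ε ∧ (μ {x | ε ≤ |f x - g x|}).toReal ≤ lam * ε}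

/-- The distance `me₁` for maps into a metric space. -/
def meDistMap {α Y : Type*} [MeasurableSpace α] [PseudoMetricSpace Y]
    (μ : Measure α) (f g : α → Y) : ℝ :=
  sInf {ε : ℝ | 0 < ε ∧ (μ {x | ε ≤ dist (f x) (g x)}).toReal ≤ ε}

/-- `Lip_1(d)`: the real valued functions that are `1`-Lipschitz w.r.t. a semi-distance `d`. -/
def Lip1 {α : Type*} (d : α → α → ℝ) : Set (α → ℝ) := {f | ∀ x y, |f x - f y| ≤ d x y}

/-- `d` is a semi-distance function. -/
structure IsSemiDist {α : Type*} (d : α → α → ℝ) : Prop where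
  refl : ∀ x, d x x = 0
  symm : ∀ x y, d x y = d y x
  triangle : ∀ x y z, d x z ≤ d x y + d y z

/-- `H_λLι₁(d, d')`: the Hausdorff distance between `Lip_1(d)` and `Lip_1(d')` in
`(𝓕(α, ℝ), me_λ)`. -/
def HL {α : Type*} [MeasurableSpace α] (μ : Measure α) (lam : ℝ) (d d' : α → α → ℝ) : ℝ :=
  sInf {ε : ℝ | 0 < ε ∧ (∀ f ∈ Lip1 d, ∃ g ∈ Lip1 d', meDist μ lam f g ≤ ε) ∧
    (∀ g ∈ Lip1 d', ∃ f ∈ Lip1 d, meDist μ lam f g ≤ ε)}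

/-- `inf H_λLι₁(φX*d_X, φY*d_Y)` over all parameters, for mm-spaces of equal total mass `m`. -/
def obsInf {X Y : Type*} [PseudoMetricSpace X] [MeasurableSpace X]
    [PseudoMetricSpace Y] [MeasurableSpace Y] (lam m : ℝ)
    (μX : Measure X) (μY : Measure Y) : ℝ :=
  sInf {r : ℝ | ∃ (φX : ℝ → X) (φY : ℝ → Y), IsParameter μX m φX ∧ IsParameter μY m φY ∧
    r = HL (lebIcc m) lam (pb φX) (pb φY)}

open Classical in
/-- Gromov's observable distance `H̲_λLι₁(X, Y)` between mm-spaces. -/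
def mmObs {X Y : Type*} [PseudoMetricSpace X] [MeasurableSpace X]
    [PseudoMetricSpace Y] [MeasurableSpace Y] (lam : ℝ)
    (μX : Measure X) (μY : Measure Y) : ℝ :=
  if (μX univ).toReal = (μY univ).toReal then
    obsInf lam (μX univ).toReal μX μY
  else if (μX univ).toReal < (μY univ).toReal then
    obsInf lam (μX univ).toReal μX
      ((ENNReal.ofReal ((μX univ).toReal / (μY univ).toReal)) • μY)
      + ((μY univ).toReal - (μX univ).toReal)
  else
    obsInf lam (μY univ).toReal
      ((ENNReal.ofReal ((μY univ).toReal / (μX univ).toReal)) • μX) μY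
      + ((μX univ).toReal - (μY univ).toReal)

/-- `f : X → Y` is `λ`-Lipschitz up to `ε`. -/
def LipUpTo {X Y : Type*} [PseudoMetricSpace X] [PseudoMetricSpace Y] [MeasurableSpace X]
    (μX : Measure X) (lam ε : ℝ) (f : X → Y) : Prop :=
  ∃ X₀ : Set X, MeasurableSet X₀ ∧ (μX X₀ᶜ).toReal ≤ ε ∧
    ∀ x ∈ X₀, ∀ x' ∈ X₀, dist (f x) (f x') ≤ lam * dist x x' + ε

/-- Weak convergence of a sequence of finite Borel measures: convergence of integrals of
all bounded continuous functions. -/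
def WeakConv {Y : Type*} [TopologicalSpace Y] [MeasurableSpace Y]
    (μs : ℕ → Measure Y) (μ : Measure Y) : Prop :=
  ∀ g : BoundedContinuousFunction Y ℝ,
    Tendsto (fun n => ∫ y, g y ∂(μs n)) atTop (𝓝 (∫ y, g y ∂μ))

/-- `X` Lipschitz dominates `Y`: there are a `1`-Lipschitz map `p : Supp μX → Supp μY` and
`c ≥ 1` with `p_*(μX) = c • μY`. -/
def LipDom {X Y : Type*} [MetricSpace X] [MeasurableSpace X] [MetricSpace Y] [MeasurableSpace Y]
    (μX : Measure X) (μY : Measure Y) : Prop :=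
  ∃ (p : msupport μX → msupport μY) (c : ℝ), 1 ≤ c ∧
    (∀ a b : msupport μX, dist (p a) (p b) ≤ dist a b) ∧
    Measure.map p (Measure.comap Subtype.val μX)
      = (ENNReal.ofReal c) • Measure.comap Subtype.val μY

end

section Coupling

variable {X Y : Type*} [MeasurableSpace X] [MeasurableSpace Y]

/-- Two finite measures of the same total mass have a coupling. -/
lemma exists_coupling (μ : Measure Y) (ν : Measure X) [IsFiniteMeasure μ] [IsFiniteMeasure ν]
    (h : μ univ = ν univ) : ∃ π : Measure (Y × X), π.fst = μ ∧ π.snd = ν := by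
  by_cases h0 : μ univ = 0
  · refine ⟨0, ?_, ?_⟩
    · simp [Measure.measure_univ_eq_zero.1 h0]
    · simp [Measure.measure_univ_eq_zero.1 (h ▸ h0)]
  refine ⟨(μ univ)⁻¹ • μ.prod ν, ?_, ?_⟩
  · ext s hs
    rw [Measure.fst_apply hs, ← prod_univ, Measure.smul_apply, Measure.prod_prod, ← h,
      smul_eq_mul, mul_comm (μ s), ← mul_assoc, ENNReal.inv_mul_cancel h0 (measure_ne_top _ _),
      one_mul]
  · ext s hs
    rw [Measure.snd_apply hs, ← univ_prod, Measure.smul_apply, Measure.prod_prod,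
      smul_eq_mul, ← mul_assoc, ENNReal.inv_mul_cancel h0 (measure_ne_top _ _), one_mul]

/-- Parts of equal mass of two finite measures can be matched by a coupling. -/
lemma exists_coupling_of_parts (μ : Measure Y) (ν : Measure X) [IsFiniteMeasure μ]
    [IsFiniteMeasure ν] (h : μ univ = ν univ) (s : Finset ℕ) (μs : ℕ → Measure Y)
    (νs : ℕ → Measure X) (hmass : ∀ k ∈ s, μs k univ = νs k univ)
    (hμ : ∑ k ∈ s, μs k ≤ μ) (hν : ∑ k ∈ s, νs k ≤ ν)
    (A : ℕ → Set Y) (B : ℕ → Set X) (hA : ∀ k ∈ s, MeasurableSet (A k))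
    (hB : ∀ k ∈ s, MeasurableSet (B k))
    (hμA : ∀ k ∈ s, μs k (A k)ᶜ = 0) (hνB : ∀ k ∈ s, νs k (B k)ᶜ = 0) :
    ∃ π : Measure (Y × X), π.fst = μ ∧ π.snd = ν ∧
      π (⋃ k ∈ s, A k ×ˢ B k)ᶜ ≤ μ univ - ∑ k ∈ s, μs k univ := by
  have hfin : ∀ k ∈ s, IsFiniteMeasure (μs k) ∧ IsFiniteMeasure (νs k) := fun k hk => by
    have h1 : μs k ≤ μ := (Finset.single_le_sum (fun _ _ => Measure.zero_le _) hk).trans hμ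
    have h2 : νs k ≤ ν := (Finset.single_le_sum (fun _ _ => Measure.zero_le _) hk).trans hν
    exact ⟨isFiniteMeasure_of_le _ h1, isFiniteMeasure_of_le _ h2⟩
  have hex : ∀ k, ∃ π : Measure (Y × X), k ∈ s → π.fst = μs k ∧ π.snd = νs k := fun k => by
    by_cases hk : k ∈ s
    · have := (hfin k hk).1
      have := (hfin k hk).2
      obtain ⟨π, hπ⟩ := exists_coupling (μs k) (νs k) (hmass k hk)
      exact ⟨π, fun _ => hπ⟩
    · exact ⟨0, fun h => absurd h hk⟩
  choose πs hπs using hex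
  have : IsFiniteMeasure (∑ k ∈ s, μs k) := isFiniteMeasure_of_le _ hμ
  have : IsFiniteMeasure (∑ k ∈ s, νs k) := isFiniteMeasure_of_le _ hν
  have hsum : (∑ k ∈ s, μs k) univ = (∑ k ∈ s, νs k) univ := by
    simp only [Measure.finsetSum_apply]
    exact Finset.sum_congr rfl hmass
  have hrest : (μ - ∑ k ∈ s, μs k) univ = (ν - ∑ k ∈ s, νs k) univ := by
    rw [Measure.sub_apply .univ hμ, Measure.sub_apply .univ hν, h, hsum]
  obtain ⟨π', hπ1, hπ2⟩ := exists_coupling _ _ hrest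
  have hfst : (∑ k ∈ s, πs k).fst = ∑ k ∈ s, μs k := by
    ext t ht
    rw [Measure.fst_apply ht, Measure.finsetSum_apply, Measure.finsetSum_apply]
    exact Finset.sum_congr rfl fun k hk => by rw [← (hπs k hk).1, Measure.fst_apply ht]
  have hsnd : (∑ k ∈ s, πs k).snd = ∑ k ∈ s, νs k := by
    ext t ht
    rw [Measure.snd_apply ht, Measure.finsetSum_apply, Measure.finsetSum_apply]
    exact Finset.sum_congr rfl fun k hk => by rw [← (hπs k hk).2, Measure.snd_apply ht]
  refine ⟨π' + ∑ k ∈ s, πs k, ?_, ?_, ?_⟩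
  · rw [Measure.fst_add, hπ1, hfst, Measure.sub_add_cancel_of_le hμ]
  · rw [Measure.snd_add, hπ2, hsnd, Measure.sub_add_cancel_of_le hν]
  · rw [Measure.add_apply, Measure.finsetSum_apply, Finset.sum_eq_zero, add_zero]
    · calc π' _ ≤ π' univ := measure_mono (subset_univ _)
        _ = (μ - ∑ k ∈ s, μs k) univ := by rw [← hπ1, Measure.fst_univ]
        _ = _ := by rw [Measure.sub_apply .univ hμ, Measure.finsetSum_apply]
    · intro k hk
      refine measure_mono_null
        (t := Prod.fst ⁻¹' (A k)ᶜ ∪ Prod.snd ⁻¹' (B k)ᶜ) ?_ (measure_union_null ?_ ?_)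
      · intro z hz
        simp only [mem_compl_iff, mem_iUnion, mem_prod, not_exists, mem_union, mem_preimage] at hz ⊢
        have := hz k hk
        tauto
      · rw [← Measure.fst_apply (hA k hk).compl, (hπs k hk).1, hμA k hk]
      · rw [← Measure.snd_apply (hB k hk).compl, (hπs k hk).2, hνB k hk]

lemma sum_smul_withDensity_le (μ : Measure Y) (s : Finset ℕ) (g : ℕ → Y → ENNReal)
    (hg : ∀ k, Measurable (g k)) (hle : ∀ y, ∑ k ∈ s, g k y ≤ 1) (c : ℕ → ENNReal)
    (hc : ∀ k, c k ≤ 1) : ∑ k ∈ s, c k • μ.withDensity (g k) ≤ μ := by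
  refine Measure.le_iff.2 fun t ht => ?_
  rw [Measure.finsetSum_apply]
  calc ∑ k ∈ s, (c k • μ.withDensity (g k)) t ≤ ∑ k ∈ s, ∫⁻ y in t, g k y ∂μ := by
        refine Finset.sum_le_sum fun k _ => ?_
        rw [Measure.smul_apply, withDensity_apply _ ht, smul_eq_mul]
        exact mul_le_of_le_one_left (zero_le) (hc k)
    _ = ∫⁻ y in t, ∑ k ∈ s, g k y ∂μ := (lintegral_finsetSum _ fun k _ => hg k).symm
    _ ≤ ∫⁻ _ in t, 1 ∂μ := lintegral_mono hle
    _ = μ t := by simp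

lemma smul_withDensity_compl_support (ρ : Measure Y) (c : ENNReal) {g : Y → ENNReal}
    (hg : Measurable g) : (c • ρ.withDensity g) {z | g z ≠ 0}ᶜ = 0 := by
  have hm : MeasurableSet {z | g z ≠ 0}ᶜ := (hg (measurableSet_singleton 0).compl).compl
  rw [Measure.smul_apply, withDensity_apply _ hm, setLIntegral_congr_fun (g := 0) hm]
  · simp
  · intro z hz
    simpa using hz

lemma integrable_of_nonneg_of_le_one (ρ : Measure Y) [IsFiniteMeasure ρ] {g : Y → ℝ}
    (hg : Measurable g) (h0 : ∀ y, 0 ≤ g y) (h1 : ∀ y, g y ≤ 1) : Integrable g ρ :=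
  Integrable.of_bound hg.aestronglyMeasurable 1 (ae_of_all _ fun y => by
    rw [Real.norm_of_nonneg (h0 y)]
    exact h1 y)

lemma lintegral_ofReal_of_nonneg_of_le_one (ρ : Measure Y) [IsFiniteMeasure ρ] {g : Y → ℝ}
    (hg : Measurable g) (h0 : ∀ y, 0 ≤ g y) (h1 : ∀ y, g y ≤ 1) :
    ∫⁻ y, ENNReal.ofReal (g y) ∂ρ = ENNReal.ofReal (∫ y, g y ∂ρ) :=
  (ofReal_integral_eq_lintegral_ofReal (integrable_of_nonneg_of_le_one ρ hg h0 h1)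
    (ae_of_all _ h0)).symm

/-- Coupling of two finite measures subordinate to a family of subprobability weights. -/
lemma exists_coupling_of_weights (μ : Measure Y) (ν : Measure X) [IsFiniteMeasure μ]
    [IsFiniteMeasure ν] (h : μ univ = ν univ) (s : Finset ℕ) (p : Y → X) (hp : Measurable p)
    (f : ℕ → X → ENNReal) (hf : ∀ k, Measurable (f k)) (hle : ∀ x, ∑ k ∈ s, f k x ≤ 1) :
    ∃ π : Measure (Y × X), π.fst = μ ∧ π.snd = ν ∧
      π (⋃ k ∈ s, {y | f k (p y) ≠ 0} ×ˢ {x | f k x ≠ 0})ᶜ ≤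
        μ univ - ∑ k ∈ s, min (∫⁻ y, f k (p y) ∂μ) (∫⁻ x, f k x ∂ν) := by
  set a : ℕ → ENNReal := fun k => ∫⁻ y, f k (p y) ∂μ with ha
  set b : ℕ → ENNReal := fun k => ∫⁻ x, f k x ∂ν with hb
  have hle1 : ∀ k ∈ s, ∀ x, f k x ≤ 1 := fun k hk x =>
    (Finset.single_le_sum (f := fun k => f k x) (fun _ _ => zero_le) hk).trans (hle x)
  have hatop : ∀ k ∈ s, a k ≠ ⊤ := fun k hk => ne_top_of_le_ne_top (measure_ne_top μ univ) <|
    (lintegral_mono fun y => hle1 k hk (p y)).trans (by simp)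
  have hbtop : ∀ k ∈ s, b k ≠ ⊤ := fun k hk => ne_top_of_le_ne_top (measure_ne_top ν univ) <|
    (lintegral_mono fun y => hle1 k hk y).trans (by simp)
  have hmul : ∀ m c : ENNReal, m ≤ c → c ≠ ⊤ → m / c * c = m := fun m c hmc hc => by
    refine ENNReal.div_mul_cancel' (fun h0 => ?_) fun h1 => absurd h1 hc
    simpa [h0] using hmc
  have hmassμ : ∀ k ∈ s, ((min (a k) (b k) / a k) • μ.withDensity fun y => f k (p y)) univ
      = min (a k) (b k) := fun k hk => by
    rw [Measure.smul_apply, withDensity_apply _ .univ, Measure.restrict_univ, smul_eq_mul]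
    exact hmul _ _ (min_le_left _ _) (hatop k hk)
  have hmassν : ∀ k ∈ s, ((min (a k) (b k) / b k) • ν.withDensity (f k)) univ
      = min (a k) (b k) := fun k hk => by
    rw [Measure.smul_apply, withDensity_apply _ .univ, Measure.restrict_univ, smul_eq_mul]
    exact hmul _ _ (min_le_right _ _) (hbtop k hk)
  have hm : ∀ k, MeasurableSet {x | f k x ≠ 0} := fun k => hf k (measurableSet_singleton 0).compl
  obtain ⟨π, h1, h2, h3⟩ := exists_coupling_of_parts μ ν h s
    (fun k => (min (a k) (b k) / a k) • μ.withDensity fun y => f k (p y))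
    (fun k => (min (a k) (b k) / b k) • ν.withDensity (f k))
    (fun k hk => by rw [hmassμ k hk, hmassν k hk])
    (sum_smul_withDensity_le μ s _ (fun k => (hf k).comp hp) (fun y => hle (p y)) _
      fun k => ENNReal.div_le_of_le_mul (by rw [one_mul]; exact min_le_left _ _))
    (sum_smul_withDensity_le ν s _ hf hle _
      fun k => ENNReal.div_le_of_le_mul (by rw [one_mul]; exact min_le_right _ _))
    (fun k => {y | f k (p y) ≠ 0}) (fun k => {x | f k x ≠ 0})
    (fun k _ => hp (hm k)) (fun k _ => hm k)
    (fun k _ => smul_withDensity_compl_support μ _ ((hf k).comp hp))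
    (fun k _ => smul_withDensity_compl_support ν _ (hf k))
  refine ⟨π, h1, h2, h3.trans_eq ?_⟩
  rw [Finset.sum_congr rfl hmassμ]

/-- Every finite measure on a nonempty standard Borel space has a parameter. -/
lemma exists_isParameter [StandardBorelSpace X] [Nonempty X] (μ : Measure X) [IsFiniteMeasure μ] :
    ∃ φ : ℝ → X, IsParameter μ (μ univ).toReal φ := by
  by_cases h0 : μ univ = 0
  · refine ⟨fun _ => Classical.arbitrary X, measurable_const, ?_⟩
    have : lebIcc (μ univ).toReal = 0 := by simp [lebIcc, h0]
    rw [this, Measure.map_zero, Measure.measure_univ_eq_zero.1 h0]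
  set M := (μ univ).toReal with hM
  have hMpos : 0 < M := ENNReal.toReal_pos h0 (measure_ne_top _ _)
  have hMof : ENNReal.ofReal M = μ univ := ENNReal.ofReal_toReal (measure_ne_top _ _)
  have : IsProbabilityMeasure ((μ univ)⁻¹ • μ) :=
    ⟨by rw [Measure.smul_apply, smul_eq_mul, ENNReal.inv_mul_cancel h0 (measure_ne_top _ _)]⟩
  obtain ⟨f, hf, hmap⟩ := Measure.exists_measurable_map_eq ((μ univ)⁻¹ • μ)
  have hproj : Measurable (projIcc (0 : ℝ) 1 zero_le_one) := continuous_projIcc.measurable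
  have hscale : Measurable fun t : ℝ => M⁻¹ * t := measurable_const_mul _
  have hleb : (lebIcc M).map (fun t => M⁻¹ * t) = ENNReal.ofReal M • lebIcc 1 := by
    have hpre : Icc 0 M = (fun t => M⁻¹ * t) ⁻¹' Icc 0 1 := by
      ext t
      simp only [mem_Icc, mem_preimage, inv_mul_eq_div, div_le_one hMpos, div_nonneg_iff]
      constructor
      · exact fun h => ⟨.inl ⟨h.1, hMpos.le⟩, h.2⟩
      · rintro ⟨h | h, h'⟩
        · exact ⟨h.1, h'⟩
        · exact absurd h.2 (not_le.2 hMpos)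
    rw [lebIcc, hpre, ← Measure.restrict_map hscale measurableSet_Icc,
      Real.map_volume_mul_left (inv_ne_zero hMpos.ne'), inv_inv, abs_of_pos hMpos,
      Measure.restrict_smul, lebIcc]
  have hone : (lebIcc 1).map (projIcc (0 : ℝ) 1 zero_le_one) = volume := by
    have h := unitInterval.measurePreserving_coe.map_eq
    change _ = lebIcc 1 at h
    rw [← h, Measure.map_map hproj measurable_subtype_coe]
    convert Measure.map_id
    ext t
    simp
  refine ⟨f ∘ projIcc (0 : ℝ) 1 zero_le_one ∘ fun t => M⁻¹ * t, hf.comp (hproj.comp hscale), ?_⟩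
  rw [← Measure.map_map hf (hproj.comp hscale), ← Measure.map_map hproj hscale, hleb,
    Measure.map_smul, hone, Measure.map_smul, hmap, smul_smul, hMof,
    ENNReal.mul_inv_cancel h0 (measure_ne_top _ _), one_smul]

end Coupling

section Box

variable {X Y : Type*} [MetricSpace X] [MeasurableSpace X] [MetricSpace Y] [MeasurableSpace Y]

lemma boxDist_nonneg {α : Type*} [MeasurableSpace α] (μ : Measure α) (lam : ℝ)
    (d₁ d₂ : α → α → ℝ) : 0 ≤ boxDist μ lam d₁ d₂ :=
  Real.sInf_nonneg fun _ h => h.1.le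

lemma boxInf_nonneg (lam m : ℝ) (μ : Measure Y) (ν : Measure X) : 0 ≤ boxInf lam m μ ν :=
  Real.sInf_nonneg <| by
    rintro _ ⟨_, _, _, _, rfl⟩
    exact boxDist_nonneg _ _ _ _

lemma boxInf_eq_zero_of_isEmpty [IsEmpty (Y × X)] (lam m : ℝ) (μ : Measure Y) (ν : Measure X) :
    boxInf lam m μ ν = 0 := by
  unfold boxInf
  convert Real.sInf_empty
  rw [eq_empty_iff_forall_notMem]
  rintro _ ⟨φ, ψ, -⟩
  exact isEmptyElim (φ 0, ψ 0)

lemma mmBox_nonneg (lam : ℝ) (μ : Measure Y) (ν : Measure X) : 0 ≤ mmBox lam μ ν := by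
  unfold mmBox
  split_ifs with h1 h2
  · exact boxInf_nonneg _ _ _ _
  · exact add_nonneg (boxInf_nonneg _ _ _ _) (sub_nonneg.2 h2.le)
  · exact add_nonneg (boxInf_nonneg _ _ _ _) (sub_nonneg.2 (not_lt.1 h2))

/-- A coupling bounds the box distance. -/
lemma boxInf_le_of_coupling [StandardBorelSpace X] [StandardBorelSpace Y]
    (μ : Measure Y) (ν : Measure X) [IsFiniteMeasure μ] (π : Measure (Y × X))
    (hfst : π.fst = μ) (hsnd : π.snd = ν) (T : Set (Y × X)) (hT : MeasurableSet T) {D : ℝ}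
    (hD : 0 < D) (hTD : (π Tᶜ).toReal ≤ D)
    (hd : ∀ z ∈ T, ∀ w ∈ T, |dist z.1 w.1 - dist z.2 w.2| ≤ D) :
    boxInf 1 (μ univ).toReal μ ν ≤ D := by
  rcases isEmpty_or_nonempty (Y × X) with he | he
  · rw [boxInf_eq_zero_of_isEmpty]
    exact hD.le
  have huniv : π univ = μ univ := by rw [← hfst, Measure.fst_univ]
  have : IsFiniteMeasure π := ⟨by rw [huniv]; exact measure_lt_top _ _⟩
  obtain ⟨φ, hφ, hmap⟩ := exists_isParameter π
  rw [huniv] at hmap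
  have h1 : IsParameter μ (μ univ).toReal (fun t => (φ t).1) :=
    ⟨measurable_fst.comp hφ, by
      conv_rhs => rw [← hfst, Measure.fst, ← hmap, Measure.map_map measurable_fst hφ]
      rfl⟩
  have h2 : IsParameter ν (μ univ).toReal (fun t => (φ t).2) :=
    ⟨measurable_snd.comp hφ, by
      conv_rhs => rw [← hsnd, Measure.snd, ← hmap, Measure.map_map measurable_snd hφ]
      rfl⟩
  refine (show boxInf 1 (μ univ).toReal μ ν ≤ _ from
    csInf_le ⟨0, ?_⟩ ⟨_, _, h1, h2, rfl⟩).trans ?_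
  · rintro _ ⟨_, _, _, _, rfl⟩
    exact boxDist_nonneg _ _ _ _
  refine csInf_le ⟨0, fun _ h => h.1.le⟩ ⟨hD, φ ⁻¹' T, hφ hT, ?_, ?_⟩
  · have e1 : lebIcc (μ univ).toReal univ = π univ := by
      rw [← hmap, Measure.map_apply hφ .univ, preimage_univ]
    have e2 : lebIcc (μ univ).toReal (φ ⁻¹' T) = π T := by
      conv_rhs => rw [← hmap, Measure.map_apply hφ hT]
    rw [e1, e2, one_mul]
    have := measureReal_add_measureReal_compl (μ := π) hT
    simp only [Measure.real] at this
    linarith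
  · exact fun s hs t ht => hd (φ s) hs (φ t) ht

variable [BorelSpace X]

/-- Comparison of the weights of small cells bounds the box distance. -/
lemma boxInf_le_of_weights [StandardBorelSpace X] [StandardBorelSpace Y]
    (μ : Measure Y) (ν : Measure X) [IsFiniteMeasure μ] [IsFiniteMeasure ν]
    (h : μ univ = ν univ) (s : Finset ℕ) (p : Y → X) (hp : Measurable p) (c : ℕ → X)
    (F : ℕ → X → ℝ) (hF : ∀ k, Continuous (F k)) (hF0 : ∀ k x, 0 ≤ F k x)
    (hF1 : ∀ x, ∑ k ∈ s, F k x ≤ 1) {δ ε L D : ℝ}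
    (hFc : ∀ k x, F k x ≠ 0 → dist x (c k) ≤ δ)
    (hL : L ≤ ∑ k ∈ s, min (∫ y, F k (p y) ∂μ) (∫ x, F k x ∂ν))
    (Yt : Set Y) (hYt : MeasurableSet Yt) (hε : (μ Ytᶜ).toReal ≤ ε)
    (hiso : ∀ x ∈ Yt, ∀ y ∈ Yt, |dist x y - dist (p x) (p y)| ≤ ε)
    (hD : 0 < D) (hD1 : (μ univ).toReal - L + ε ≤ D) (hD2 : ε + 4 * δ ≤ D) :
    boxInf 1 (μ univ).toReal μ ν ≤ D := by
  have hFle : ∀ k ∈ s, ∀ x, F k x ≤ 1 := fun k hk x =>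
    (Finset.single_le_sum (f := fun k => F k x) (fun j _ => hF0 j x) hk).trans (hF1 x)
  obtain ⟨π, hfst, hsnd, hπ⟩ := exists_coupling_of_weights μ ν h s p hp
    (fun k x => ENNReal.ofReal (F k x)) (fun k => (hF k).measurable.ennreal_ofReal)
    (fun x => by
      rw [← ENNReal.ofReal_sum_of_nonneg fun k _ => hF0 k x]
      exact ENNReal.ofReal_le_one.2 (hF1 x))
  have hsum : ∑ k ∈ s, min (∫⁻ y, ENNReal.ofReal (F k (p y)) ∂μ) (∫⁻ x, ENNReal.ofReal (F k x) ∂ν)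
      = ENNReal.ofReal (∑ k ∈ s, min (∫ y, F k (p y) ∂μ) (∫ x, F k x ∂ν)) := by
    rw [ENNReal.ofReal_sum_of_nonneg fun k _ =>
      le_min (integral_nonneg fun _ => hF0 _ _) (integral_nonneg fun _ => hF0 _ _)]
    refine Finset.sum_congr rfl fun k hk => ?_
    rw [lintegral_ofReal_of_nonneg_of_le_one μ (g := fun y => F k (p y)) ((hF k).measurable.comp hp)
        (fun _ => hF0 k _) fun _ => hFle k hk _,
      lintegral_ofReal_of_nonneg_of_le_one ν (hF k).measurable (hF0 k) (hFle k hk)]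
    exact (ENNReal.ofReal_mono.map_min).symm
  have huniv : π univ = μ univ := by rw [← hfst, Measure.fst_univ]
  have : IsFiniteMeasure π := ⟨by rw [huniv]; exact measure_lt_top _ _⟩
  set U : Set (Y × X) := ⋃ k ∈ s, {y | ENNReal.ofReal (F k (p y)) ≠ 0} ×ˢ
    {x | ENNReal.ofReal (F k x) ≠ 0} with hU
  have hUm : MeasurableSet U := by
    refine Finset.measurableSet_biUnion _ fun k _ => ?_
    have hm : MeasurableSet {x | ENNReal.ofReal (F k x) ≠ 0} :=
      (hF k).measurable.ennreal_ofReal (measurableSet_singleton 0).compl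
    exact (hp hm).prod hm
  have hUd : ∀ z ∈ U, dist (p z.1) z.2 ≤ 2 * δ := fun z hz => by
    simp only [hU, mem_iUnion, mem_prod, mem_ofPred_eq] at hz
    obtain ⟨k, -, h1, h2⟩ := hz
    have h1' := hFc k (p z.1) fun h0 => h1 (by simp [h0])
    have h2' := hFc k z.2 fun h0 => h2 (by simp [h0])
    linarith [dist_triangle_right (p z.1) z.2 (c k)]
  refine boxInf_le_of_coupling μ ν π hfst hsnd (Prod.fst ⁻¹' Yt ∩ U)
    ((measurable_fst hYt).inter hUm) hD ?_ ?_
  · rw [hsum] at hπ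
    set S := ∑ k ∈ s, min (∫ y, F k (p y) ∂μ) (∫ x, F k x ∂ν)
    have hSM : S ≤ (μ univ).toReal := by
      calc S ≤ ∑ k ∈ s, ∫ y, F k (p y) ∂μ := Finset.sum_le_sum fun k _ => min_le_left _ _
        _ = ∫ y, ∑ k ∈ s, F k (p y) ∂μ := by
            exact (integral_finsetSum _ fun k hk => integrable_of_nonneg_of_le_one μ
              ((hF k).measurable.comp hp) (fun _ => hF0 k _) fun _ => hFle k hk _).symm
        _ ≤ ∫ _, 1 ∂μ := integral_mono_of_nonneg
            (ae_of_all _ fun y => Finset.sum_nonneg fun k _ => hF0 _ _) (integrable_const _)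
            (ae_of_all _ fun y => hF1 _)
        _ = (μ univ).toReal := by simp [Measure.real]
    have hπU : (π Uᶜ).toReal ≤ (μ univ).toReal - S := by
      refine ENNReal.toReal_le_of_le_ofReal (sub_nonneg.2 hSM) (hπ.trans_eq ?_)
      rw [ENNReal.ofReal_sub _ (Finset.sum_nonneg fun k _ =>
        le_min (integral_nonneg fun _ => hF0 _ _) (integral_nonneg fun _ => hF0 _ _)),
        ENNReal.ofReal_toReal (measure_ne_top _ _)]
    have hπY : (π (Prod.fst ⁻¹' Yt)ᶜ).toReal ≤ ε := by
      rwa [← preimage_compl, ← Measure.fst_apply hYt.compl, hfst]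
    have := measureReal_union_le (μ := π) (Prod.fst ⁻¹' Yt)ᶜ Uᶜ
    rw [← compl_inter] at this
    simp only [Measure.real] at this
    linarith
  · rintro z ⟨hz, hzU⟩ w ⟨hw, hwU⟩
    have h1 := abs_le.1 (hiso z.1 hz w.1 hw)
    have h2 := abs_le.1 (abs_dist_sub_le (p z.1) z.2 (p w.1))
    have h3 := abs_le.1 (abs_dist_sub_le (p w.1) w.2 z.2)
    rw [dist_comm (p w.1) z.2, dist_comm w.2 z.2] at h3
    have := hUd z hzU
    have := hUd w hwU
    rw [abs_le]
    constructor <;> linarith [h1.1, h1.2, h2.1, h2.2, h3.1, h3.2]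

end Box

/-- The capped distance to the first `k` points of a sequence, rescaled by `δ`. -/
noncomputable def cappedDist {X : Type*} [MetricSpace X] (c : ℕ → X) (δ : ℝ) : ℕ → X → ℝ
  | 0, _ => 1
  | k + 1, x => min (cappedDist c δ k x) (dist x (c k) / δ)

section CappedDist

variable {X : Type*} [MetricSpace X] (c : ℕ → X) {δ : ℝ}

lemma continuous_cappedDist (k : ℕ) : Continuous (cappedDist c δ k) := by
  induction k with
  | zero => exact continuous_const
  | succ k ih => exact ih.min ((continuous_id.dist continuous_const).div_const _)

lemma cappedDist_nonneg (hδ : 0 < δ) (k : ℕ) (x : X) : 0 ≤ cappedDist c δ k x := by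
  induction k with
  | zero => exact zero_le_one
  | succ k ih => exact le_min ih (by positivity)

lemma cappedDist_succ_le (k : ℕ) (x : X) : cappedDist c δ (k + 1) x ≤ cappedDist c δ k x :=
  min_le_left _ _

lemma cappedDist_antitone (x : X) : Antitone fun k => cappedDist c δ k x :=
  antitone_nat_of_succ_le fun k => cappedDist_succ_le c k x

lemma cappedDist_le_one (k : ℕ) (x : X) : cappedDist c δ k x ≤ 1 :=
  cappedDist_antitone c x (Nat.zero_le k)

lemma dist_le_of_cappedDist_sub_ne_zero (hδ : 0 < δ) {k : ℕ} {x : X}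
    (h : cappedDist c δ k x - cappedDist c δ (k + 1) x ≠ 0) : dist x (c k) ≤ δ := by
  by_contra! hlt
  refine h (sub_eq_zero.2 (min_eq_left ?_).symm)
  exact (cappedDist_le_one c k x).trans ((one_le_div hδ).2 hlt.le)

lemma tendsto_cappedDist (hδ : 0 < δ) (hc : DenseRange c) (x : X) :
    Tendsto (fun k => cappedDist c δ k x) atTop (𝓝 0) := by
  refine tendsto_order.2 ⟨fun a ha => .of_forall fun k => ha.trans_le (cappedDist_nonneg c hδ k x),
    fun a ha => ?_⟩
  obtain ⟨j, hj⟩ := hc.exists_dist_lt x (mul_pos ha hδ)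
  filter_upwards [eventually_ge_atTop (j + 1)] with k hk
  exact ((cappedDist_antitone c x hk).trans (min_le_right _ _)).trans_lt ((div_lt_iff₀ hδ).2 hj)

lemma tendsto_integral_cappedDist [MeasurableSpace X] [BorelSpace X]
    [SecondCountableTopology X] (hδ : 0 < δ) (hc : DenseRange c)
    (μ : Measure X) [IsFiniteMeasure μ] :
    Tendsto (fun k => ∫ x, cappedDist c δ k x ∂μ) atTop (𝓝 0) := by
  have := tendsto_integral_of_dominated_convergence (μ := μ) (F := fun k => cappedDist c δ k)
    (f := fun _ => (0 : ℝ)) (fun _ => 1)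
    (fun k => (continuous_cappedDist c k).aestronglyMeasurable) (integrable_const _)
    (fun k => ae_of_all _ fun x => by
      rw [Real.norm_of_nonneg (cappedDist_nonneg c hδ k x)]
      exact cappedDist_le_one c k x)
    (ae_of_all _ fun x => tendsto_cappedDist c hδ hc x)
  simpa using this

lemma integrable_cappedDist [MeasurableSpace X] [BorelSpace X]
    [SecondCountableTopology X] (hδ : 0 < δ) (μ : Measure X) [IsFiniteMeasure μ] (k : ℕ) :
    Integrable (cappedDist c δ k) μ :=
  integrable_of_nonneg_of_le_one μ (continuous_cappedDist c k).measurable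
    (cappedDist_nonneg c hδ k) (cappedDist_le_one c k)

end CappedDist

/-- The defining cases of `mmBox`, expressed through a common rescaling of both measures. -/
lemma mmBox_le_of_forall_scaled {X Y : Type*} [MetricSpace X] [MeasurableSpace X] [MetricSpace Y]
    [MeasurableSpace Y] (μ : Measure Y) (ν : Measure X) [IsFiniteMeasure μ] [IsFiniteMeasure ν]
    {D : ℝ} (h : ∀ s t : ℝ, 0 ≤ s → s ≤ 1 → 0 ≤ t → t ≤ 1 →
      s * (μ univ).toReal = t * (ν univ).toReal →
      (1 - s) * (μ univ).toReal + (1 - t) * (ν univ).toReal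
        ≤ |(μ univ).toReal - (ν univ).toReal| →
      boxInf 1 (s * (μ univ).toReal) (ENNReal.ofReal s • μ) (ENNReal.ofReal t • ν) ≤ D) :
    mmBox 1 μ ν ≤ D + |(μ univ).toReal - (ν univ).toReal| := by
  set a := (μ univ).toReal
  set b := (ν univ).toReal
  have ha : 0 ≤ a := ENNReal.toReal_nonneg
  have hb : 0 ≤ b := ENNReal.toReal_nonneg
  unfold mmBox
  split_ifs with h1 h2
  · have := h 1 1 zero_le_one le_rfl zero_le_one le_rfl (by rw [one_mul, one_mul]; exact h1)
      (by simp)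
    rw [ENNReal.ofReal_one, one_smul, one_smul, one_mul] at this
    exact this.trans (le_add_of_nonneg_right (abs_nonneg _))
  · have hb' : 0 < b := ha.trans_lt h2
    have e : a / b * b = a := div_mul_cancel₀ _ hb'.ne'
    have := h 1 (a / b) zero_le_one le_rfl (by positivity) ((div_le_one hb').2 h2.le)
      (by rw [e, one_mul]) (by rw [abs_of_neg (sub_neg.2 h2), sub_mul (1 : ℝ) (a / b), e]; linarith)
    rw [ENNReal.ofReal_one, one_smul, one_mul] at this
    rw [abs_of_neg (sub_neg.2 h2)]
    linarith
  · have h2' : b < a := lt_of_le_of_ne (not_lt.1 h2) (Ne.symm h1)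
    have ha' : 0 < a := hb.trans_lt h2'
    have e : b / a * a = b := div_mul_cancel₀ _ ha'.ne'
    have := h (b / a) 1 (by positivity) ((div_le_one ha').2 h2'.le) zero_le_one le_rfl
      (by rw [e, one_mul]) (by rw [abs_of_pos (sub_pos.2 h2'), sub_mul (1 : ℝ) (b / a), e]; linarith)
    rw [ENNReal.ofReal_one, one_smul, e] at this
    rw [abs_of_pos (sub_pos.2 h2')]
    linarith

/-- the criterion (1)-(4) implies `□̲₁(X_n, X) → 0`. -/
theorem box_conv_of_maps {X : Type*}
    [MetricSpace X] [CompleteSpace X] [TopologicalSpace.SeparableSpace X]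
    [MeasurableSpace X] [BorelSpace X]
    (μX : Measure X) [IsFiniteMeasure μX]
    (Xn : ℕ → Type*) [∀ n, MetricSpace (Xn n)] [∀ n, CompleteSpace (Xn n)]
    [∀ n, TopologicalSpace.SeparableSpace (Xn n)]
    [∀ n, MeasurableSpace (Xn n)] [∀ n, BorelSpace (Xn n)]
    (μXn : ∀ n, Measure (Xn n)) [∀ n, IsFiniteMeasure (μXn n)]
    (p : ∀ n, Xn n → X) (Xt : ∀ n, Set (Xn n)) (ε : ℕ → ℝ)
    (hp : ∀ n, Measurable (p n)) (hXt : ∀ n, MeasurableSet (Xt n))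
    (hεpos : ∀ n, 0 < ε n)
    (h1 : Tendsto ε atTop (𝓝 0))
    (h2 : ∀ n, (μXn n ((Xt n)ᶜ)).toReal ≤ ε n)
    (h3 : ∀ n, ∀ x ∈ Xt n, ∀ y ∈ Xt n, |dist x y - dist (p n x) (p n y)| ≤ ε n)
    (h4 : WeakConv (fun n => Measure.map (p n) (μXn n)) μX) :
    Tendsto (fun n => mmBox 1 (μXn n) μX) atTop (𝓝 0) := by
  have : SecondCountableTopology X := UniformSpace.secondCountable_of_separable X
  have : ∀ n, SecondCountableTopology (Xn n) := fun n =>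
    UniformSpace.secondCountable_of_separable (Xn n)
  refine tendsto_order.2 ⟨fun a ha => .of_forall fun n => ha.trans_le (mmBox_nonneg _ _ _),
    fun D hD => ?_⟩
  set m := (μX univ).toReal with hm
  set mn : ℕ → ℝ := fun n => (μXn n univ).toReal with hmn
  have hmass : Tendsto (fun n => |mn n - m|) atTop (𝓝 0) := by
    have h := h4 (BoundedContinuousFunction.const X 1)
    simp only [BoundedContinuousFunction.const_apply, integral_const, smul_eq_mul, mul_one,
      Measure.real, Measure.map_apply (hp _) MeasurableSet.univ, preimage_univ] at h
    simpa [hm, hmn] using (h.sub_const m).abs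
  rcases isEmpty_or_nonempty X with hX | hX
  · filter_upwards [hmass.eventually (gt_mem_nhds hD)] with n hn
    refine (mmBox_le_of_forall_scaled (D := 0) _ _ fun s t _ _ _ _ _ _ => ?_).trans_lt
      (by rwa [zero_add])
    rw [boxInf_eq_zero_of_isEmpty]
  set c := TopologicalSpace.denseSeq X
  have hc : DenseRange c := TopologicalSpace.denseRange_denseSeq X
  set δ := D / 16 with hδdef
  have hδ : 0 < δ := by positivity
  set u := cappedDist c δ
  set F : ℕ → X → ℝ := fun k x => u k x - u (k + 1) x with hFdef
  have hFcont : ∀ k, Continuous (F k) := fun k =>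
    (continuous_cappedDist c k).sub (continuous_cappedDist c (k + 1))
  have hF0 : ∀ k x, 0 ≤ F k x := fun k x => sub_nonneg.2 (cappedDist_succ_le c k x)
  have hF1 : ∀ k x, F k x ≤ 1 := fun k x => by
    linarith [cappedDist_le_one c (δ := δ) k x, cappedDist_nonneg c hδ (k + 1) x]
  have hFsum : ∀ K x, ∑ k ∈ Finset.range K, F k x = 1 - u K x := fun K x =>
    Finset.sum_range_sub' (fun k => u k x) K
  obtain ⟨K, hK⟩ := ((tendsto_integral_cappedDist c hδ hc μX).eventually
    (gt_mem_nhds (show (0 : ℝ) < D / 8 by positivity))).exists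
  set a : ℕ → ℕ → ℝ := fun n k => ∫ y, F k (p n y) ∂(μXn n) with hadef
  set b : ℕ → ℝ := fun k => ∫ x, F k x ∂μX with hbdef
  have hab : ∀ k, Tendsto (fun n => a n k) atTop (𝓝 (b k)) := fun k => by
    have h := h4 (BoundedContinuousFunction.ofNormedAddCommGroup (F k) (hFcont k) 1 fun x => by
      rw [Real.norm_of_nonneg (hF0 k x)]
      exact hF1 k x)
    refine h.congr fun n => ?_
    exact integral_map (hp n).aemeasurable (hFcont k).aestronglyMeasurable
  have hsum : Tendsto (fun n => ∑ k ∈ Finset.range K, |a n k - b k|) atTop (𝓝 0) := by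
    have h := tendsto_finsetSum (Finset.range K) fun k _ => ((hab k).sub_const (b k)).abs
    simpa using h
  have hbsum : ∑ k ∈ Finset.range K, b k = m - ∫ x, u K x ∂μX := by
    have hFint : ∀ k ∈ Finset.range K, Integrable (F k) μX := fun k _ =>
      (integrable_cappedDist c hδ μX k).sub (integrable_cappedDist c hδ μX (k + 1))
    rw [hbdef, ← integral_finsetSum _ hFint]
    simp only [hFsum]
    rw [integral_sub (integrable_const _) (integrable_cappedDist c hδ μX K)]
    simp only [integral_const, Measure.real, smul_eq_mul, mul_one, hm, u]
  have hev : ∀ᶠ n in atTop, (|mn n - m| < D / 8 ∧ ε n < D / 8) ∧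
      ∑ k ∈ Finset.range K, |a n k - b k| < D / 8 := by
    have h8 : (0 : ℝ) < D / 8 := by positivity
    exact ((hmass.eventually (gt_mem_nhds h8)).and (h1.eventually (gt_mem_nhds h8))).and
      (hsum.eventually (gt_mem_nhds h8))
  filter_upwards [hev] with n hn
  obtain ⟨⟨hn1, hn2⟩, hn3⟩ := hn
  refine (mmBox_le_of_forall_scaled (D := D / 2) (μXn n) μX ?_).trans_lt
    (show D / 2 + |mn n - m| < D by linarith)
  intro s t hs0 hs1 ht0 ht1 hst hdef
  change s * mn n = t * m at hst
  change (1 - s) * mn n + (1 - t) * m ≤ |mn n - m| at hdef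
  have hsmass : ((ENNReal.ofReal s • μXn n) univ).toReal = s * mn n := by
    rw [Measure.smul_apply, smul_eq_mul, ENNReal.toReal_mul, ENNReal.toReal_ofReal hs0]
  have htmass : ((ENNReal.ofReal t • μX) univ).toReal = t * m := by
    rw [Measure.smul_apply, smul_eq_mul, ENNReal.toReal_mul, ENNReal.toReal_ofReal ht0]
  have : IsFiniteMeasure (ENNReal.ofReal s • μXn n) := Measure.smul_finite _ ENNReal.ofReal_ne_top
  have : IsFiniteMeasure (ENNReal.ofReal t • μX) := Measure.smul_finite _ ENNReal.ofReal_ne_top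
  change boxInf 1 (s * mn n) _ _ ≤ D / 2
  rw [← hsmass]
  have hasum : ∑ k ∈ Finset.range K, a n k ≤ mn n := by
    have hFint : ∀ k ∈ Finset.range K, Integrable (fun y => F k (p n y)) (μXn n) := fun k _ =>
      integrable_of_nonneg_of_le_one _ ((hFcont k).measurable.comp (hp n)) (fun _ => hF0 k _)
        fun _ => hF1 k _
    calc ∑ k ∈ Finset.range K, a n k = ∫ y, ∑ k ∈ Finset.range K, F k (p n y) ∂(μXn n) :=
          (integral_finsetSum _ hFint).symm
      _ ≤ ∫ _, 1 ∂(μXn n) := integral_mono_of_nonneg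
          (ae_of_all _ fun y => Finset.sum_nonneg fun k _ => hF0 k _) (integrable_const _)
          (ae_of_all _ fun y => by
            change ∑ k ∈ Finset.range K, F k (p n y) ≤ 1
            rw [hFsum]
            linarith [cappedDist_nonneg c hδ K (p n y)])
      _ = mn n := by simp [Measure.real, hmn]
  have hu0 : 0 ≤ ∫ x, u K x ∂μX := integral_nonneg fun x => cappedDist_nonneg c hδ K x
  have htm : t * m ≤ m := mul_le_of_le_one_left ENNReal.toReal_nonneg ht1
  have hscale : ENNReal.ofReal s ≤ 1 := ENNReal.ofReal_le_one.2 hs1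
  refine boxInf_le_of_weights (ENNReal.ofReal s • μXn n) (ENNReal.ofReal t • μX) ?_
    (Finset.range K) (p n) (hp n) c F hFcont hF0 ?_ (δ := δ) (ε := ε n)
    (L := m - (∫ x, u K x ∂μX) - (∑ k ∈ Finset.range K, |a n k - b k|) - |mn n - m|)
    (fun k x h => dist_le_of_cappedDist_sub_ne_zero c hδ h) ?_ (Xt n) (hXt n) ?_ (h3 n)
    (by positivity) ?_ ?_
  · rw [← ENNReal.toReal_eq_toReal_iff' (measure_ne_top _ _) (measure_ne_top _ _), hsmass, htmass,
      hst]
  · intro x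
    rw [hFsum]
    linarith [cappedDist_nonneg c hδ K x]
  · simp only [integral_smul_measure, ENNReal.toReal_ofReal hs0, ENNReal.toReal_ofReal ht0,
      smul_eq_mul]
    have hterm : ∀ k ∈ Finset.range K,
        b k - |a n k - b k| - (1 - s) * a n k - (1 - t) * b k ≤ min (s * a n k) (t * b k) := by
      intro k _
      have ha0 : 0 ≤ a n k := integral_nonneg fun _ => hF0 k _
      have hb0 : 0 ≤ b k := integral_nonneg fun _ => hF0 k _
      have h1 := mul_nonneg (sub_nonneg.2 hs1) ha0
      have h2 := mul_nonneg (sub_nonneg.2 ht1) hb0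
      have h3 := neg_abs_le (a n k - b k)
      have h4 := abs_nonneg (a n k - b k)
      exact le_min (by linarith) (by linarith)
    refine le_trans ?_ (Finset.sum_le_sum hterm)
    simp only [Finset.sum_sub_distrib, ← Finset.mul_sum]
    rw [hbsum]
    have h1 := mul_le_mul_of_nonneg_left hasum (sub_nonneg.2 hs1)
    have h2 : (1 - t) * (m - ∫ x, u K x ∂μX) ≤ (1 - t) * m :=
      mul_le_mul_of_nonneg_left (by linarith) (sub_nonneg.2 ht1)
    linarith
  · refine le_trans (ENNReal.toReal_mono (measure_ne_top _ _) ?_) (h2 n)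
    rw [Measure.smul_apply, smul_eq_mul]
    exact mul_le_of_le_one_left (zero_le) hscale
  · rw [hsmass, hst]
    linarith
  · rw [hδdef]
    linarith
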